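/- Let n ≥ 1 and m ≥ 1, let X = Fin n → ZMod 2 and Ym = Fin m → ZMod 2, and consider the Hilbert space H = EuclideanSpace ℂ (X × Ym × (X → Ym)). Let U_O be the permutation unitary induced on standard basis vectors by (x, y, r) ↦ (x, y + r x, r); let H_F be the Hadamard transform on the F-register, i.e. the unitary with matrix entries ⟨e_{(x', y', s)}, H_F e_{(x, y, r)}⟩ = δ_{x,x'} · δ_{y,y'} · 2^{−m·2ⁿ/2} · (−1)^{Σ_{x''∈X} Σ_{j} (r x'' j)·(s x'' j)} (products of ZMod 2 elements taken after lifting to {0,1} ⊆ ℤ); and let U_FO := H_F · U_O · H_F be the Fourier Oracle unitary. Let N be the number operator on H, the diagonal operator with N e_{(x,y,r)} = |{x' ∈ X : r x' ≠ 0}| · e_{(x,y,r)}. Then the operator norm of the commutator satisfies ‖N · U_FO − U_FO · N‖ = 1. -/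

import Mathlib

noncomputable section

/-- Index set of the computational basis: query input register `X = Fin n → ZMod 2`,
query output register `Ym = Fin m → ZMod 2`, Fourier Oracle register `X → Ym`. -/
abbrev QIdx (n m : ℕ) :=
  (Fin n → ZMod 2) × (Fin m → ZMod 2) × ((Fin n → ZMod 2) → (Fin m → ZMod 2))

/-- The standard oracle unitary `U_O`, the permutation matrix induced on standard basis
vectors by `(x, y, r) ↦ (x, y + r x, r)`. -/
def UOmat (n m : ℕ) : Matrix (QIdx n m) (QIdx n m) ℂ := fun p q =>
  if p = (q.1, q.2.1 + q.2.2 q.1, q.2.2) then 1 else 0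

/-- The Hadamard transform `H_F` on the Fourier-Oracle register, with matrix entries
`⟨e_(x',y',s), H_F e_(x,y,r)⟩ = δ_{x,x'} δ_{y,y'} 2^{-m·2ⁿ/2} (-1)^{Σ_{x''} Σ_j (r x'' j)(s x'' j)}`. -/
def HFmat (n m : ℕ) : Matrix (QIdx n m) (QIdx n m) ℂ := fun p q =>
  if p.1 = q.1 ∧ p.2.1 = q.2.1 then
    ((((Real.sqrt 2) ^ (m * 2 ^ n))⁻¹ : ℝ) : ℂ) *
      (-1 : ℂ) ^ (∑ x'' : Fin n → ZMod 2, ∑ j : Fin m, (q.2.2 x'' j).val * (p.2.2 x'' j).val)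
  else 0

/-- The Fourier Oracle unitary `U_FO = H_F · U_O · H_F`. -/
def UFOmat (n m : ℕ) : Matrix (QIdx n m) (QIdx n m) ℂ :=
  HFmat n m * UOmat n m * HFmat n m

/-- The number operator `N`, the diagonal operator counting the number of inputs at which
the oracle-register function `r` is nonzero. -/
def Nmat (n m : ℕ) : Matrix (QIdx n m) (QIdx n m) ℂ :=
  Matrix.diagonal fun p =>
    (((Finset.univ.filter fun x' : Fin n → ZMod 2 => p.2.2 x' ≠ 0).card : ℕ) : ℂ)

variable {n m : ℕ}

/-- The character pairing `(-1)^{r · s}` on the Fourier Oracle register. -/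
def registerSign (r s : (Fin n → ZMod 2) → (Fin m → ZMod 2)) : ℂ :=
  ∏ x, ∏ j, (-1 : ℂ) ^ ((r x j).val * (s x j).val)

/-- The oracle-register function with the single nonzero bit `j` at input `x`. -/
def singleBit (x : Fin n → ZMod 2) (j : Fin m) : (Fin n → ZMod 2) → (Fin m → ZMod 2) :=
  Pi.single x (Pi.single j 1)

lemma neg_one_pow_val_add (a b : ZMod 2) :
    (-1 : ℂ) ^ (a + b).val = (-1) ^ a.val * (-1) ^ b.val := by
  rw [ZMod.val_add, ← neg_one_pow_eq_pow_mod_two, pow_add]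

lemma neg_one_pow_val_add_mul (a b c : ZMod 2) :
    (-1 : ℂ) ^ ((a + b).val * c.val) = (-1) ^ (a.val * c.val) * (-1) ^ (b.val * c.val) := by
  rw [pow_mul, neg_one_pow_val_add, mul_pow, ← pow_mul, ← pow_mul]

lemma neg_one_pow_val_mul_neg_one_pow_val {a b : ZMod 2} (h : a ≠ b) :
    (-1 : ℂ) ^ a.val * (-1) ^ b.val = -1 := by
  rw [← neg_one_pow_val_add, (by revert a b; decide : a + b = 1), ZMod.val_one, pow_one]

lemma registerSign_comm (r s : (Fin n → ZMod 2) → (Fin m → ZMod 2)) :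
    registerSign r s = registerSign s r := by
  simp only [registerSign, mul_comm]

lemma registerSign_add_left (r r' s : (Fin n → ZMod 2) → (Fin m → ZMod 2)) :
    registerSign (r + r') s = registerSign r s * registerSign r' s := by
  simp only [registerSign, Pi.add_apply, neg_one_pow_val_add_mul, Finset.prod_mul_distrib]

lemma registerSign_mul_self (r s : (Fin n → ZMod 2) → (Fin m → ZMod 2)) :
    registerSign r s * registerSign r s = 1 := by
  simp only [registerSign, ← Finset.prod_mul_distrib, ← pow_add]
  simp [← two_mul]

lemma star_registerSign (r s : (Fin n → ZMod 2) → (Fin m → ZMod 2)) :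
    star (registerSign r s) = registerSign r s := by
  simp [registerSign]

lemma registerSign_zero_left (s : (Fin n → ZMod 2) → (Fin m → ZMod 2)) :
    registerSign 0 s = 1 := by
  simp [registerSign]

lemma registerSign_singleBit_left (x : Fin n → ZMod 2) (j : Fin m)
    (s : (Fin n → ZMod 2) → (Fin m → ZMod 2)) :
    registerSign (singleBit x j) s = (-1) ^ (s x j).val := by
  rw [registerSign, Finset.prod_eq_single x, Finset.prod_eq_single j]
  · simp [singleBit, ZMod.val_one]
  · intro b _ hb
    simp [singleBit, hb]
  · simp
  · intro b _ hb
    simp [singleBit, hb]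
  · simp

lemma HFmat_apply (p q : QIdx n m) :
    HFmat n m p q = if p.1 = q.1 ∧ p.2.1 = q.2.1 then
      ((((Real.sqrt 2) ^ (m * 2 ^ n))⁻¹ : ℝ) : ℂ) * registerSign q.2.2 p.2.2 else 0 := by
  simp only [HFmat, registerSign, Finset.prod_pow_eq_pow_sum]

lemma HFmat_apply_comm (p q : QIdx n m) : HFmat n m p q = HFmat n m q p := by
  simp only [HFmat_apply, registerSign_comm q.2.2, eq_comm (a := p.1), eq_comm (a := p.2.1)]

/-- The basis permutation `(x, y, r) ↦ (x, y + r x, r)`. -/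
def oracleMap (p : QIdx n m) : QIdx n m := (p.1, p.2.1 + p.2.2 p.1, p.2.2)

lemma oracleMap_involutive : Function.Involutive (oracleMap (n := n) (m := m)) := by
  intro p
  have h : p.2.2 p.1 + p.2.2 p.1 = 0 := by
    ext j
    simp [CharTwo.add_self_eq_zero]
  simp [oracleMap, add_assoc, h]

lemma UOmat_apply (p q : QIdx n m) : UOmat n m p q = if oracleMap p = q then 1 else 0 := by
  have : p = oracleMap q ↔ oracleMap p = q := by
    rw [← oracleMap_involutive.eq_iff, eq_comm]
  exact if_congr this rfl rfl

/-- Flipping bit `j` of the oracle register at input `x`. -/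
def flipBit (x : Fin n → ZMod 2) (j : Fin m) : Equiv.Perm (QIdx n m) :=
  (Equiv.refl _).prodCongr ((Equiv.refl _).prodCongr (Equiv.addRight (singleBit x j)))

lemma HFmat_flipBit (x : Fin n → ZMod 2) (j : Fin m) (p q : QIdx n m) :
    HFmat n m p (flipBit x j q) = HFmat n m p q * (-1) ^ (p.2.2 x j).val := by
  simp only [HFmat_apply, flipBit, Equiv.prodCongr_apply, Prod.map_fst, Prod.map_snd,
    Equiv.refl_apply, Equiv.coe_addRight, registerSign_add_left, registerSign_singleBit_left,
    ite_mul, zero_mul, mul_assoc]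

lemma HFmat_flipBit_left (x : Fin n → ZMod 2) (j : Fin m) (p q : QIdx n m) :
    HFmat n m (flipBit x j p) q = (-1) ^ (q.2.2 x j).val * HFmat n m p q := by
  rw [HFmat_apply_comm, HFmat_flipBit, HFmat_apply_comm, mul_comm]

lemma oracleMap_flipBit {x : Fin n → ZMod 2} (j : Fin m) {p : QIdx n m} (h : p.1 ≠ x) :
    oracleMap (flipBit x j p) = flipBit x j (oracleMap p) := by
  simp [oracleMap, flipBit, singleBit, h]

lemma sum_eq_zero_of_comp_equiv_eq_neg {ι : Type*} [Fintype ι] (e : Equiv.Perm ι) (f : ι → ℂ)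
    (h : ∀ i, f (e i) = -f i) : ∑ i, f i = 0 := by
  have := Equiv.sum_comp e f
  simp only [h, Finset.sum_neg_distrib] at this
  exact self_eq_neg.mp this.symm

lemma UFOmat_apply (p q : QIdx n m) :
    UFOmat n m p q = ∑ b, HFmat n m p (oracleMap b) * HFmat n m b q := by
  rw [UFOmat, Matrix.mul_assoc, Matrix.mul_apply,
    ← Equiv.sum_comp (oracleMap_involutive (n := n) (m := m)).toPerm]
  refine Finset.sum_congr rfl fun b _ => ?_
  simp [Matrix.mul_apply, UOmat_apply, oracleMap_involutive b]

lemma HFmat_mul_HFmat : HFmat n m * HFmat n m = 1 := by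
  ext p q
  rw [Matrix.mul_apply, Matrix.one_apply]
  split_ifs with h
  · subst h
    obtain ⟨x, y, r⟩ := p
    simp only [HFmat_apply_comm _ (x, y, r)]
    simp only [HFmat_apply, Fintype.sum_prod_type]
    rw [Finset.sum_eq_single x, Finset.sum_eq_single y]
    · have hs (t : (Fin n → ZMod 2) → (Fin m → ZMod 2)) (c : ℂ) :
          c * registerSign t r * (c * registerSign t r) = c ^ 2 := by
        rw [mul_mul_mul_comm, registerSign_mul_self, mul_one, sq]
      have h2 : ((Real.sqrt 2 ^ (m * 2 ^ n))⁻¹ ^ 2 : ℝ) = ((2 : ℝ) ^ (m * 2 ^ n))⁻¹ := by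
        rw [inv_pow, ← pow_mul, mul_comm _ 2, pow_mul, Real.sq_sqrt zero_le_two]
      simp only [and_self, if_true, hs, Finset.sum_const, Finset.card_univ, ← Complex.ofReal_pow,
        h2]
      simp [ZMod.card, ← pow_mul]
    · intro b _ hb
      simp [hb.symm]
    · simp
    · intro b _ hb
      simp [hb.symm]
    · simp
  · by_cases hr : p.2.2 = q.2.2
    · refine Finset.sum_eq_zero fun b _ => ?_
      simp only [HFmat_apply]
      split_ifs with h1 h2
      · exact absurd (Prod.ext (h1.1.trans h2.1) (Prod.ext (h1.2.trans h2.2) hr)) h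
      all_goals simp
    · obtain ⟨x, hx⟩ := Function.ne_iff.mp hr
      obtain ⟨j, hj⟩ := Function.ne_iff.mp hx
      refine sum_eq_zero_of_comp_equiv_eq_neg (flipBit x j) _ fun b => ?_
      rw [HFmat_flipBit, HFmat_flipBit_left]
      linear_combination (HFmat n m p b * HFmat n m b q) * neg_one_pow_val_mul_neg_one_pow_val hj

lemma UFOmat_apply_eq_zero_of_fst_ne {p q : QIdx n m} (h : p.1 ≠ q.1) :
    UFOmat n m p q = 0 := by
  rw [UFOmat_apply]
  refine Finset.sum_eq_zero fun b _ => ?_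
  simp only [HFmat_apply, oracleMap]
  split_ifs with h1 h2
  · exact absurd (h1.1.trans h2.1) h
  all_goals simp

lemma UFOmat_apply_eq_zero_of_ne {p q : QIdx n m} {x : Fin n → ZMod 2} (hx : q.1 ≠ x)
    (h : p.2.2 x ≠ q.2.2 x) : UFOmat n m p q = 0 := by
  obtain ⟨j, hj⟩ := Function.ne_iff.mp h
  rw [UFOmat_apply]
  refine sum_eq_zero_of_comp_equiv_eq_neg (flipBit x j) _ fun b => ?_
  by_cases hb : b.1 = q.1
  · rw [oracleMap_flipBit j (hb ▸ hx), HFmat_flipBit, HFmat_flipBit_left]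
    linear_combination
      (HFmat n m p (oracleMap b) * HFmat n m b q) * neg_one_pow_val_mul_neg_one_pow_val hj
  · have hb' : (flipBit x j b).1 ≠ q.1 := hb
    simp [HFmat_apply _ q, hb, hb']

lemma star_HFmat : star (HFmat n m) = HFmat n m := by
  ext p q
  rw [Matrix.star_apply, HFmat_apply_comm, HFmat_apply]
  split_ifs
  · rw [star_mul', star_registerSign, ← starRingEnd_apply, Complex.conj_ofReal]
  · exact star_zero ℂ

lemma HFmat_mem_unitary : HFmat n m ∈ unitary (Matrix (QIdx n m) (QIdx n m) ℂ) := by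
  simp [Unitary.mem_iff, star_HFmat, HFmat_mul_HFmat]

lemma star_UOmat : star (UOmat n m) = UOmat n m := by
  ext p q
  simp only [Matrix.star_apply, UOmat_apply, oracleMap_involutive.eq_iff, eq_comm (a := q)]
  split_ifs <;> simp

lemma UOmat_mul_UOmat : UOmat n m * UOmat n m = 1 := by
  ext p q
  simp only [Matrix.mul_apply, UOmat_apply, Matrix.one_apply, ite_mul, one_mul, zero_mul,
    Finset.sum_ite_eq, Finset.mem_univ, if_true, oracleMap_involutive p]

lemma UOmat_mem_unitary : UOmat n m ∈ unitary (Matrix (QIdx n m) (QIdx n m) ℂ) := by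
  simp [Unitary.mem_iff, star_UOmat, UOmat_mul_UOmat]

lemma UFOmat_mem_unitary : UFOmat n m ∈ unitary (Matrix (QIdx n m) (QIdx n m) ℂ) :=
  mul_mem (mul_mem HFmat_mem_unitary UOmat_mem_unitary) HFmat_mem_unitary

/-- The reflection recording whether the oracle register vanishes at the queried input. -/
def queryReflection (n m : ℕ) : Matrix (QIdx n m) (QIdx n m) ℂ :=
  Matrix.diagonal fun p => if p.2.2 p.1 ≠ 0 then 1 else -1

lemma commutator_eq_half_commutator_queryReflection :
    Nmat n m * UFOmat n m - UFOmat n m * Nmat n m =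
      (1 / 2 : ℂ) • (queryReflection n m * UFOmat n m - UFOmat n m * queryReflection n m) := by
  ext p q
  simp only [Nmat, queryReflection, Matrix.sub_apply, Matrix.smul_apply, Matrix.diagonal_mul,
    Matrix.mul_diagonal, smul_eq_mul]
  by_cases hU : UFOmat n m p q = 0
  · simp [hU]
  have hx : p.1 = q.1 := by
    by_contra h
    exact hU (UFOmat_apply_eq_zero_of_fst_ne h)
  have hr (x) (h : q.1 ≠ x) : p.2.2 x = q.2.2 x := by
    by_contra h'
    exact hU (UFOmat_apply_eq_zero_of_ne h h')
  have hrest : ∑ x ∈ Finset.univ.erase q.1, (if p.2.2 x ≠ 0 then (1 : ℂ) else 0) =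
      ∑ x ∈ Finset.univ.erase q.1, (if q.2.2 x ≠ 0 then (1 : ℂ) else 0) :=
    Finset.sum_congr rfl fun x h => by rw [hr x (Finset.ne_of_mem_erase h).symm]
  simp only [Finset.natCast_card_filter]
  rw [← Finset.add_sum_erase _ _ (Finset.mem_univ q.1), hrest,
    ← Finset.add_sum_erase Finset.univ (fun x => if q.2.2 x ≠ 0 then (1 : ℂ) else 0)
      (Finset.mem_univ q.1), hx]
  split_ifs <;> ring

/-- The unnormalised vector `∑ y, (-1)^{y j} |0, y, r⟩`. -/
def phaseVector (j : Fin m) (r : (Fin n → ZMod 2) → (Fin m → ZMod 2)) : QIdx n m → ℂ := fun p =>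
  if p.1 = 0 ∧ p.2.2 = r then (-1) ^ (p.2.1 j).val else 0

lemma HFmat_mulVec_phaseVector (j : Fin m) (r : (Fin n → ZMod 2) → (Fin m → ZMod 2))
    (p : QIdx n m) :
    (HFmat n m).mulVec (phaseVector j r) p = if p.1 = 0 then
      ((((Real.sqrt 2) ^ (m * 2 ^ n))⁻¹ : ℝ) : ℂ) * registerSign r p.2.2 *
        (-1) ^ (p.2.1 j).val else 0 := by
  obtain ⟨x, y, t⟩ := p
  rw [Matrix.mulVec, dotProduct, Finset.sum_eq_single (x, y, r)]
  · simp [HFmat_apply, phaseVector]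
  · rintro ⟨x', y', t'⟩ - hb
    simp only [HFmat_apply, phaseVector]
    split_ifs with h1 h2
    · obtain ⟨rfl, rfl⟩ := h1
      exact absurd (by rw [h2.2]) hb
    all_goals simp
  · simp

lemma UOmat_mulVec_apply (f : QIdx n m → ℂ) (p : QIdx n m) :
    (UOmat n m).mulVec f p = f (oracleMap p) := by
  simp [Matrix.mulVec, dotProduct, UOmat_apply]

lemma UFOmat_mulVec_phaseVector_zero (j : Fin m) :
    (UFOmat n m).mulVec (phaseVector j 0) = phaseVector j (singleBit 0 j) := by
  have h : (UOmat n m).mulVec ((HFmat n m).mulVec (phaseVector j 0)) =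
      (HFmat n m).mulVec (phaseVector j (singleBit 0 j)) := by
    ext p
    rw [UOmat_mulVec_apply, HFmat_mulVec_phaseVector, HFmat_mulVec_phaseVector]
    by_cases hp : p.1 = 0
    · simp [oracleMap, hp, registerSign_zero_left, registerSign_singleBit_left,
        neg_one_pow_val_add]
      ring
    · simp [oracleMap, hp]
  rw [UFOmat, ← Matrix.mulVec_mulVec, ← Matrix.mulVec_mulVec, h, Matrix.mulVec_mulVec,
    HFmat_mul_HFmat, Matrix.one_mulVec]

lemma UFOmat_mul_UFOmat : UFOmat n m * UFOmat n m = 1 := by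
  calc UFOmat n m * UFOmat n m
      = HFmat n m * (UOmat n m * (HFmat n m * HFmat n m) * UOmat n m) * HFmat n m := by
        simp only [UFOmat, Matrix.mul_assoc]
    _ = 1 := by rw [HFmat_mul_HFmat, Matrix.mul_one, UOmat_mul_UOmat, Matrix.mul_one,
        HFmat_mul_HFmat]

lemma Nmat_mulVec_phaseVector_zero (j : Fin m) :
    (Nmat n m).mulVec (phaseVector j 0) = 0 := by
  ext p
  rw [Nmat, Matrix.mulVec_diagonal, phaseVector]
  split_ifs with h
  · simp [h.2]
  · simp

lemma Nmat_mulVec_phaseVector_singleBit (x : Fin n → ZMod 2) (j : Fin m) :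
    (Nmat n m).mulVec (phaseVector j (singleBit x j)) = phaseVector j (singleBit x j) := by
  ext p
  rw [Nmat, Matrix.mulVec_diagonal, phaseVector]
  split_ifs with h
  · simp [h.2, singleBit, Pi.single_apply, Finset.filter_eq']
  · simp

lemma phaseVector_ne_zero (j : Fin m) (r : (Fin n → ZMod 2) → (Fin m → ZMod 2)) :
    phaseVector j r ≠ 0 := fun h => by
  simpa [phaseVector] using congrFun h (0, 0, r)

open scoped Matrix.Norms.L2Operator in
lemma norm_commutator_le_one : ‖Nmat n m * UFOmat n m - UFOmat n m * Nmat n m‖ ≤ 1 := by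
  have hR : ‖queryReflection n m‖ ≤ 1 := by
    rw [queryReflection, Matrix.l2_opNorm_diagonal, pi_norm_le_iff_of_nonneg zero_le_one]
    intro p
    split_ifs <;> simp
  rw [commutator_eq_half_commutator_queryReflection, norm_smul]
  have := norm_sub_le (queryReflection n m * UFOmat n m) (UFOmat n m * queryReflection n m)
  rw [CStarRing.norm_mul_mem_unitary _ UFOmat_mem_unitary,
    CStarRing.norm_mem_unitary_mul _ UFOmat_mem_unitary] at this
  norm_num
  linarith

open scoped Matrix.Norms.L2Operator in
lemma one_le_norm_commutator (j : Fin m) :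
    1 ≤ ‖Nmat n m * UFOmat n m - UFOmat n m * Nmat n m‖ := by
  set v : EuclideanSpace ℂ (QIdx n m) := WithLp.toLp 2 (phaseVector j 0) with hv
  set w : EuclideanSpace ℂ (QIdx n m) := WithLp.toLp 2 (phaseVector j (singleBit 0 j)) with hw
  have hvw : ‖v‖ ≤ ‖w‖ := by
    have h := (UFOmat n m).l2_opNorm_mulVec w
    rw [CStarRing.norm_of_mem_unitary UFOmat_mem_unitary, one_mul, hw,
      ← UFOmat_mulVec_phaseVector_zero, Matrix.mulVec_mulVec, UFOmat_mul_UFOmat,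
      Matrix.one_mulVec, UFOmat_mulVec_phaseVector_zero] at h
    exact h
  have hwv : ‖w‖ ≤ ‖Nmat n m * UFOmat n m - UFOmat n m * Nmat n m‖ * ‖v‖ := by
    have h := (Nmat n m * UFOmat n m - UFOmat n m * Nmat n m).l2_opNorm_mulVec v
    rw [hv, Matrix.sub_mulVec, ← Matrix.mulVec_mulVec, ← Matrix.mulVec_mulVec,
      UFOmat_mulVec_phaseVector_zero, Nmat_mulVec_phaseVector_zero,
      Nmat_mulVec_phaseVector_singleBit, Matrix.mulVec_zero, sub_zero] at h
    exact h
  have hpos : 0 < ‖v‖ := norm_pos_iff.mpr fun h =>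
    phaseVector_ne_zero j 0 (congrArg WithLp.ofLp h)
  exact le_of_mul_le_mul_right (by rw [one_mul]; exact hvw.trans hwv) hpos

/-- The operator norm of the commutator of the number operator with the Fourier Oracle
unitary equals `1`. -/
theorem number_operator_commutator_norm (n m : ℕ) (hn : 1 ≤ n) (hm : 1 ≤ m) :
    ‖LinearMap.toContinuousLinearMap
        (Matrix.toEuclideanLin (Nmat n m * UFOmat n m - UFOmat n m * Nmat n m))‖ = 1 :=
  le_antisymm norm_commutator_le_one (one_le_norm_commutator ⟨0, hm⟩)

end
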